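/- Let Ω ⊆ ℝ^{d₁} be an open convex set, let f : Ω → ℝ^{d₂} be piecewise linear with decomposition {(P_i, T_i, t_i)}_{i=1}^k, and let U be a real (d₂ × d₁)-matrix such that |J_f(x)_{ij}| ≤ U_{ij} for all indices i, j and all points x ∈ Ω at which f is differentiable. Then for all 1 ≤ p, q ≤ ∞, L_{p→q}(f, Ω) ≤ ‖U‖_{p→q}. -/

import Mathlib

open scoped ENNReal BigOperators

/-- The ℓ^p norm on `ℝ^n`, for `p : ℝ≥0∞` (with `p = ∞` giving the max norm). -/
noncomputable def lpNorm (p : ℝ≥0∞) {n : ℕ} (x : Fin n → ℝ) : ℝ :=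
  if p = ⊤ then ⨆ i, |x i| else (∑ i, |x i| ^ p.toReal) ^ (1 / p.toReal)

/-- The induced `(p → q)` operator norm of a matrix: `sup_{x ≠ 0} ‖Tx‖_q / ‖x‖_p`. -/
noncomputable def opNorm (p q : ℝ≥0∞) {m n : ℕ} (T : Matrix (Fin m) (Fin n) ℝ) : ℝ :=
  ⨆ x : {x : Fin n → ℝ // x ≠ 0}, lpNorm q (T.mulVec x.1) / lpNorm p x.1

/-- The `(p → q)` Lipschitz norm of `f` over `Ω`:
`sup_{x ≠ y ∈ Ω} ‖f x − f y‖_q / ‖x − y‖_p`. -/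
noncomputable def lipNorm (p q : ℝ≥0∞) {n m : ℕ}
    (f : (Fin n → ℝ) → (Fin m → ℝ)) (Ω : Set (Fin n → ℝ)) : ℝ :=
  sSup {r | ∃ x ∈ Ω, ∃ y ∈ Ω, x ≠ y ∧ r = lpNorm q (f x - f y) / lpNorm p (x - y)}

/-- A polyhedron in `ℝ^n`: a set of the form `{x : A x ≤ b}` (componentwise). -/
def IsPolyhedron {n : ℕ} (P : Set (Fin n → ℝ)) : Prop :=
  ∃ (r : ℕ) (A : Matrix (Fin r) (Fin n) ℝ) (b : Fin r → ℝ),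
    P = {x | ∀ i, A.mulVec x i ≤ b i}

/-- The Jacobian matrix of `f` at `x` (the matrix of the Fréchet derivative `fderiv ℝ f x`). -/
noncomputable def jacobianMatrix {n m : ℕ} (f : (Fin n → ℝ) → (Fin m → ℝ))
    (x : Fin n → ℝ) : Matrix (Fin m) (Fin n) ℝ :=
  LinearMap.toMatrix' (fderiv ℝ f x).toLinearMap

theorem lpNorm_eq_norm_toLp (p : ℝ≥0∞) [Fact (1 ≤ p)] {n : ℕ} (x : Fin n → ℝ) :
    lpNorm p x = ‖WithLp.toLp p x‖ := by
  unfold lpNorm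
  split_ifs with h
  · subst h
    simp [PiLp.norm_eq_ciSup]
  · have hp : 1 ≤ p := Fact.out
    rw [PiLp.norm_eq_sum (ENNReal.toReal_pos (by positivity) h)]
    simp

theorem lpNorm_nonneg (p : ℝ≥0∞) {n : ℕ} (x : Fin n → ℝ) : 0 ≤ lpNorm p x := by
  unfold lpNorm
  split_ifs with h
  · exact Real.iSup_nonneg fun i => abs_nonneg _
  · positivity

theorem lpNorm_mono_abs (p : ℝ≥0∞) {n : ℕ} {x y : Fin n → ℝ} (h : ∀ i, |x i| ≤ |y i|) :
    lpNorm p x ≤ lpNorm p y := by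
  unfold lpNorm
  split_ifs
  · exact ciSup_mono (Set.finite_range _).bddAbove h
  · refine Real.rpow_le_rpow (by positivity) (Finset.sum_le_sum fun i _ => ?_) (by positivity)
    exact Real.rpow_le_rpow (abs_nonneg _) (h i) ENNReal.toReal_nonneg

theorem bddAbove_range_lpNorm_div (p q : ℝ≥0∞) (hp : 1 ≤ p) (hq : 1 ≤ q) {m n : ℕ}
    (T : Matrix (Fin m) (Fin n) ℝ) :
    BddAbove (Set.range fun x : {x : Fin n → ℝ // x ≠ 0} =>
      lpNorm q (T.mulVec x.1) / lpNorm p x.1) := by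
  have : Fact (1 ≤ p) := ⟨hp⟩
  have : Fact (1 ≤ q) := ⟨hq⟩
  let L : PiLp p (fun _ : Fin n => ℝ) →ₗ[ℝ] PiLp q (fun _ : Fin m => ℝ) :=
    (WithLp.linearEquiv q ℝ (Fin m → ℝ)).symm.toLinearMap ∘ₗ T.mulVecLin ∘ₗ
      (WithLp.linearEquiv p ℝ (Fin n → ℝ)).toLinearMap
  refine ⟨‖L.toContinuousLinearMap‖, ?_⟩
  rintro _ ⟨x, rfl⟩
  simp only [lpNorm_eq_norm_toLp]
  exact L.toContinuousLinearMap.ratio_le_opNorm (WithLp.toLp p x.1)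

theorem opNorm_nonneg (p q : ℝ≥0∞) {m n : ℕ} (T : Matrix (Fin m) (Fin n) ℝ) :
    0 ≤ opNorm p q T :=
  Real.iSup_nonneg fun _ => div_nonneg (lpNorm_nonneg _ _) (lpNorm_nonneg _ _)

theorem lpNorm_mulVec_div_le_opNorm (p q : ℝ≥0∞) (hp : 1 ≤ p) (hq : 1 ≤ q) {m n : ℕ}
    (T : Matrix (Fin m) (Fin n) ℝ) {x : Fin n → ℝ} (hx : x ≠ 0) :
    lpNorm q (T.mulVec x) / lpNorm p x ≤ opNorm p q T :=
  le_ciSup (bddAbove_range_lpNorm_div p q hp hq T) ⟨x, hx⟩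

theorem IsPolyhedron.isClosed {n : ℕ} {P : Set (Fin n → ℝ)} (h : IsPolyhedron P) :
    IsClosed P := by
  obtain ⟨r, A, b, rfl⟩ := h
  rw [Set.ofPred_forall]
  exact isClosed_iInter fun i => isClosed_le
    ((continuous_apply i).comp (Continuous.matrix_mulVec continuous_const continuous_id))
    continuous_const

/-- A continuous function on `[0, 1]` whose increments are at most `C` times the length on each
member of a finite closed cover increases by at most `C`. -/
theorem sub_le_of_finite_closed_cover {ι : Type*} [Finite ι] {g : ℝ → ℝ} {C : ℝ}
    {S : ι → Set ℝ} (hS : ∀ l, IsClosed (S l)) (hcov : Set.Icc 0 1 ⊆ ⋃ l, S l)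
    (hg : ContinuousOn g (Set.Icc 0 1))
    (hC : ∀ l, ∀ s ∈ S l, ∀ r ∈ S l, s < r → g r - g s ≤ C * (r - s)) :
    g 1 - g 0 ≤ C := by
  have key : ∀ ⦃x⦄, x ∈ Set.Icc (0 : ℝ) 1 → g x ≤ g 0 + C * x := by
    refine image_le_of_liminf_slope_right_le_deriv_boundary (B' := fun _ => C) hg (by simp)
      (by fun_prop) (fun x _ => ?_) (fun x hx r hr => ?_)
    · simpa using (((hasDerivAt_id x).const_mul C).const_add (g 0)).hasDerivWithinAt
    · have hev : ∀ᶠ z in nhdsWithin x (Set.Ioi x), ∃ l, z ∈ S l := by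
        filter_upwards [Ioo_mem_nhdsGT hx.2] with z hz
        simpa using hcov ⟨hx.1.trans hz.1.le, hz.2.le⟩
      obtain ⟨l, hl⟩ : ∃ l, ∃ᶠ z in nhdsWithin x (Set.Ioi x), z ∈ S l := by
        by_contra! hcon
        obtain ⟨z, ⟨l, hl⟩, hz⟩ := (hev.and (Filter.eventually_all.2 hcon)).exists
        exact hz l hl
      have hxl : x ∈ S l :=
        (hS l).mem_of_frequently_of_tendsto hl (Filter.tendsto_id.mono_left nhdsWithin_le_nhds)
      refine (hl.and_eventually self_mem_nhdsWithin).mono fun z hz => lt_of_le_of_lt ?_ hr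
      have hxz : x < z := hz.2
      rw [slope_def_field, div_le_iff₀ (sub_pos.2 hxz)]
      exact hC l x hxl z hz.1 hxz
  have := key (x := 1) (by simp)
  linarith

/-- The Jacobian of a function that is affine on `P` is its linear part inside `P`. -/
theorem hasFDerivAt_of_eqOn_affine {n m : ℕ} {f : (Fin n → ℝ) → (Fin m → ℝ)}
    {P : Set (Fin n → ℝ)} {T : Matrix (Fin m) (Fin n) ℝ} {t : Fin m → ℝ}
    (hf : ∀ x ∈ P, f x = T.mulVec x + t) {x : Fin n → ℝ} (hx : x ∈ interior P) :
    HasFDerivAt f T.mulVecLin.toContinuousLinearMap x := by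
  refine (T.mulVecLin.toContinuousLinearMap.hasFDerivAt.add_const t).congr_of_eventuallyEq ?_
  filter_upwards [mem_interior_iff_mem_nhds.1 hx] with y hy
  simpa using hf y hy

theorem abs_mulVec_le_mulVec_abs {n m : ℕ} {T U : Matrix (Fin m) (Fin n) ℝ}
    (h : ∀ i j, |T i j| ≤ U i j) (x : Fin n → ℝ) (i : Fin m) :
    |T.mulVec x i| ≤ U.mulVec (fun j => |x j|) i := by
  simp only [Matrix.mulVec, dotProduct]
  refine (Finset.abs_sum_le_sum_abs _ _).trans (Finset.sum_le_sum fun j _ => ?_)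
  rw [abs_mul]
  exact mul_le_mul_of_nonneg_right (h i j) (abs_nonneg _)

/-- For an open convex `Ω`, a piecewise linear `f`, and a matrix `U`
dominating the absolute Jacobian entries of `f` at every differentiability point of
`Ω`, for all `1 ≤ p, q ≤ ∞` we have `L_{p→q}(f, Ω) ≤ ‖U‖_{p→q}`. -/
theorem lipNorm_le_opNorm_of_jacobian_abs_le
    {d₁ d₂ k : ℕ}
    (Ω : Set (Fin d₁ → ℝ)) (hΩopen : IsOpen Ω) (hΩconv : Convex ℝ Ω)
    (f : (Fin d₁ → ℝ) → (Fin d₂ → ℝ))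
    (P : Fin k → Set (Fin d₁ → ℝ))
    (T : Fin k → Matrix (Fin d₂) (Fin d₁) ℝ)
    (t : Fin k → Fin d₂ → ℝ)
    (hPoly : ∀ i, IsPolyhedron (P i))
    (hInt : ∀ i, (interior (P i)).Nonempty)
    (hDisj : ∀ i j, i ≠ j → interior (P i) ∩ interior (P j) = ∅)
    (hCover : (⋃ i, P i) = Ω)
    (hAff : ∀ i, ∀ x ∈ P i, f x = (T i).mulVec x + t i)
    (U : Matrix (Fin d₂) (Fin d₁) ℝ)
    (hU : ∀ x ∈ Ω, DifferentiableAt ℝ f x → ∀ i j, |jacobianMatrix f x i j| ≤ U i j)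
    (p q : ℝ≥0∞) (hp : 1 ≤ p) (hq : 1 ≤ q) :
    lipNorm p q f Ω ≤ opNorm p q U := by
  have hTU : ∀ l i j, |T l i j| ≤ U i j := by
    intro l i j
    obtain ⟨x, hx⟩ := hInt l
    have hd := hasFDerivAt_of_eqOn_affine (hAff l) hx
    have hxΩ : x ∈ Ω := hCover ▸ Set.mem_iUnion_of_mem l (interior_subset hx)
    have hJ : jacobianMatrix f x = T l := by
      unfold jacobianMatrix
      rw [hd.fderiv]
      exact LinearMap.toMatrix'_toLin' (T l)
    simpa [hJ] using hU x hxΩ hd.differentiableAt i j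
  have hcont : ContinuousOn f Ω := by
    rw [← hCover]
    refine (locallyFinite_of_finite P).continuousOn_iUnion (fun l => (hPoly l).isClosed)
      fun l => ContinuousOn.congr ?_ (hAff l)
    exact ((Continuous.matrix_mulVec continuous_const continuous_id).add
      continuous_const).continuousOn
  have hle : ∀ x ∈ Ω, ∀ y ∈ Ω, ∀ i, f y i - f x i ≤ U.mulVec (fun j => |y j - x j|) i := by
    intro x hx y hy i
    have hγ : Continuous (AffineMap.lineMap x y : ℝ → Fin d₁ → ℝ) :=
      AffineMap.lineMap_continuous
    have hmaps : Set.MapsTo (AffineMap.lineMap x y : ℝ → Fin d₁ → ℝ) (Set.Icc 0 1) Ω :=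
      fun s hs => hΩconv.lineMap_mem hx hy hs
    have := sub_le_of_finite_closed_cover (g := fun s => f (AffineMap.lineMap x y s) i)
      (C := U.mulVec (fun j => |y j - x j|) i)
      (S := fun l => AffineMap.lineMap x y ⁻¹' P l)
      (fun l => (hPoly l).isClosed.preimage hγ)
      (by rw [← Set.preimage_iUnion, hCover]; exact hmaps)
      ((continuous_apply i).comp_continuousOn (hcont.comp hγ.continuousOn hmaps))
      (by
        intro l s hs r hr hsr
        have hdiff : (AffineMap.lineMap x y r : Fin d₁ → ℝ) - AffineMap.lineMap x y s
            = (r - s) • (y - x) := by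
          simp only [AffineMap.lineMap_apply_module']
          module
        have hfd : f (AffineMap.lineMap x y r) i - f (AffineMap.lineMap x y s) i
            = (r - s) * (T l).mulVec (y - x) i := by
          rw [← Pi.sub_apply, hAff l _ hs, hAff l _ hr, add_sub_add_right_eq_sub,
            ← Matrix.mulVec_sub, hdiff, Matrix.mulVec_smul]
          rfl
        rw [hfd, mul_comm]
        exact mul_le_mul_of_nonneg_right
          ((le_abs_self _).trans (abs_mulVec_le_mulVec_abs (hTU l) (y - x) i))
          (sub_nonneg.2 hsr.le))
    simpa using this
  refine Real.sSup_le ?_ (opNorm_nonneg p q U)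
  rintro _ ⟨x, hx, y, hy, hxy, rfl⟩
  let v : Fin d₁ → ℝ := fun j => |x j - y j|
  have hv : v ≠ 0 := fun h => hxy (funext fun j => by
    simpa [v, sub_eq_zero] using congrFun h j)
  have hvn : lpNorm p (x - y) = lpNorm p v :=
    le_antisymm (lpNorm_mono_abs p fun i => by simp [v]) (lpNorm_mono_abs p fun i => by simp [v])
  rw [hvn]
  refine le_trans (div_le_div_of_nonneg_right (lpNorm_mono_abs q fun i => ?_)
    (lpNorm_nonneg p v)) (lpNorm_mulVec_div_le_opNorm p q hp hq U hv)
  refine le_trans (abs_le'.2 ⟨hle y hy x hx i, ?_⟩) (le_abs_self _)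
  have := hle x hx y hy i
  simp only [abs_sub_comm (y _)] at this
  simpa [v] using this
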